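/- Let q be a prime power and f(x) = c_1 x^{a_1} + ... + c_t x^{a_t} ∈ F_q[x] with t ≥ 2 and all c_i nonzero. Let C denote the size of the largest coset of a subgroup of F_q^* on which f vanishes identically (C = 1 if f vanishes on no nontrivial coset but has a root in F_q^*). Then the number R(f) of distinct roots of f in F_q^* satisfies R(f) ≤ 2·(q−1)^{1−1/(t−1)}·C^{1/(t−1)}. -/

import Mathlib

open Polynomial

/-- Simultaneous Dirichlet approximation modulo `n`, by counting boxes in `(ℤ/n)^d`. -/
theorem exists_small_simultaneous_multiple {n N m d : ℕ} (hn : 0 < n) (hmn : m ≤ n)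
    (h : n ^ d < N * m ^ d) (b : Fin d → ℤ) :
    ∃ e : ℕ, 0 < e ∧ e < N ∧ ∃ v : Fin d → ℤ,
      ∀ i, |v i| < m ∧ (n : ℤ) ∣ e * b i - v i := by
  have : NeZero n := ⟨hn.ne'⟩
  let φ : Fin N × (Fin d → Fin m) → (Fin d → ZMod n) := fun p i =>
    (((p.1 : ℕ) * b i + (p.2 i : ℕ) : ℤ) : ZMod n)
  obtain ⟨p, p', hne, heq⟩ := Fintype.exists_ne_map_eq_of_card_lt φ (by
    simpa [ZMod.card] using h)
  have key (i : Fin d) :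
      (n : ℤ) ∣ ((p'.1 : ℕ) * b i + (p'.2 i : ℕ)) - ((p.1 : ℕ) * b i + (p.2 i : ℕ)) :=
    (ZMod.intCast_eq_intCast_iff_dvd_sub _ _ _).1 (congrFun heq i)
  have h1 : (p.1 : ℕ) ≠ p'.1 := by
    intro h1
    refine hne (Prod.ext (Fin.ext h1) (funext fun i => Fin.ext ?_))
    have hk := key i
    rw [h1, add_sub_add_left_eq_sub] at hk
    have hlt := (p.2 i).2
    have hlt' := (p'.2 i).2
    have := Int.eq_zero_of_abs_lt_dvd hk (by rw [abs_lt]; omega)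
    omega
  rcases lt_or_gt_of_ne h1 with hlt | hlt
  · refine ⟨p'.1 - p.1, by omega, by omega, fun i => (p.2 i : ℕ) - (p'.2 i : ℕ), fun i => ⟨?_, ?_⟩⟩
    · have := (p.2 i).2
      have := (p'.2 i).2
      rw [abs_lt]; dsimp only; omega
    · convert key i using 1
      push_cast [hlt.le]; ring
  · refine ⟨p.1 - p'.1, by omega, by omega, fun i => (p'.2 i : ℕ) - (p.2 i : ℕ), fun i => ⟨?_, ?_⟩⟩
    · have := (p.2 i).2
      have := (p'.2 i).2
      rw [abs_lt]; dsimp only; omega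
    · obtain ⟨r, hr⟩ := key i
      refine ⟨-r, ?_⟩
      rw [Nat.cast_sub hlt.le]
      linear_combination -hr

/-- In a finite cyclic group the elements killed by `|G| / gcd(e, |G|)` are `e`-th powers. -/
theorem exists_pow_eq_of_pow_card_div_gcd_eq_one {G : Type*} [Group G] [Finite G] [IsCyclic G]
    (e : ℕ) (z : G) (hz : z ^ (Nat.card G / e.gcd (Nat.card G)) = 1) : ∃ y : G, y ^ e = z := by
  obtain ⟨g, hg⟩ := IsCyclic.exists_generator (α := G)
  obtain ⟨j, rfl⟩ := Subgroup.mem_zpowers_iff.1 (hg z)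
  have hn : 0 < Nat.card G := Nat.card_pos
  have hd : 0 < e.gcd (Nat.card G) := Nat.gcd_pos_of_pos_right _ hn
  have hk : 0 < Nat.card G / e.gcd (Nat.card G) :=
    Nat.div_pos (Nat.gcd_le_right _ hn) hd
  have hkd := Nat.div_mul_cancel (Nat.gcd_dvd_right e (Nat.card G))
  have hord := orderOf_eq_card_of_forall_mem_zpowers hg
  rw [← zpow_natCast, ← zpow_mul, ← orderOf_dvd_iff_zpow_eq_one, hord] at hz
  have hdj : ((e.gcd (Nat.card G) : ℕ) : ℤ) ∣ j := by
    refine Int.dvd_of_mul_dvd_mul_right (a := ((Nat.card G / e.gcd (Nat.card G) : ℕ) : ℤ))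
      (by exact_mod_cast hk.ne') ?_
    rwa [← Nat.cast_mul, mul_comm, hkd]
  obtain ⟨r, rfl⟩ := hdj
  refine ⟨g ^ (e.gcdA (Nat.card G) * r), ?_⟩
  rw [← zpow_natCast, ← zpow_mul, Nat.gcd_eq_gcd_ab, add_mul, zpow_add,
    mul_assoc ((Nat.card G : ℕ) : ℤ), zpow_mul g (Nat.card G : ℤ), zpow_natCast, pow_card_eq_one',
    one_zpow, mul_one]
  congr 1; ring

/-- If the exponents of `∑ i, c i * x ^ a i` become, after multiplication by `e` and translation,
congruent modulo `q - 1` to integers of absolute value at most `D`, and the sum vanishes on no coset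
of the subgroup of `e`-th powers, then it has at most `2 * D` zeros among the units. -/
theorem card_units_zeros_le {F : Type*} [Field F] [Fintype F] [DecidableEq F] {ι : Type*}
    [Fintype ι] (c : ι → F) (a : ι → ℕ) (e D : ℕ) (s : ℤ) (v : ι → ℤ) (hv : ∀ i, |v i| ≤ D)
    (hdvd : ∀ i, (Nat.card Fˣ : ℤ) ∣ e * (a i - s) - v i)
    (hvan : ∀ α : Fˣ, ∃ y : Fˣ, ∑ i, c i * ((α * y ^ e : Fˣ) : F) ^ a i ≠ 0) :
    (Finset.univ.filter fun x : Fˣ => ∑ i, c i * (x : F) ^ a i = 0).card ≤ 2 * D := by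
  set P : Fˣ → Prop := fun x => ∑ i, c i * (x : F) ^ a i = 0 with hP
  have inner (α : Fˣ) : (Finset.univ.filter fun y : Fˣ => P (α * y ^ e)).card ≤ 2 * D := by
    let g : F[X] := ∑ i, C (c i * (α : F) ^ a i) * X ^ (v i + D).toNat
    have hg (y : Fˣ) : g.eval (y : F) =
        ((y ^ ((D : ℤ) - e * s) : Fˣ) : F) * ∑ i, c i * ((α * y ^ e : Fˣ) : F) ^ a i := by
      simp only [g, eval_finsetSum, eval_mul, eval_C, eval_pow, eval_X, Finset.mul_sum]
      refine Finset.sum_congr rfl fun i _ => ?_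
      have hpow : y ^ (v i + D).toNat = y ^ ((D : ℤ) - e * s) * (y ^ e) ^ a i := by
        have hnn : 0 ≤ v i + D := by have := abs_le.1 (hv i); omega
        obtain ⟨r, hr⟩ := hdvd i
        have hvi : v i + D = ((D : ℤ) - e * s) + (e : ℤ) * a i - Nat.card Fˣ * r := by
          linear_combination -hr
        rw [← zpow_natCast, Int.toNat_of_nonneg hnn, hvi, zpow_sub, zpow_add,
          zpow_mul y (Nat.card Fˣ : ℤ), zpow_natCast y (Nat.card Fˣ), pow_card_eq_one', one_zpow,
          inv_one, mul_one, zpow_mul y (e : ℤ), zpow_natCast y, zpow_natCast]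
      have := congrArg (Units.val) hpow
      push_cast at this ⊢
      rw [this, mul_pow]
      ring
    have hg0 : g ≠ 0 := by
      intro h0
      obtain ⟨y, hy⟩ := hvan α
      have := hg y
      rw [h0, eval_zero] at this
      exact mul_ne_zero (Units.ne_zero _) hy this.symm
    have hdeg : g.natDegree ≤ 2 * D := by
      refine natDegree_sum_le_of_forall_le _ _ fun i _ => (natDegree_C_mul_X_pow_le _ _).trans ?_
      have := abs_le.1 (hv i); omega
    refine le_trans ?_ ((card_roots' g).trans hdeg)
    refine le_trans ?_ (Multiset.toFinset_card_le _)
    refine Finset.card_le_card_of_injOn (fun y : Fˣ => (y : F)) (fun y hy => ?_)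
      (fun _ _ _ _ h => Units.ext h)
    have hy' : P (α * y ^ e) := by simpa using hy
    simp only [Finset.mem_coe, Multiset.mem_toFinset, mem_roots hg0, IsRoot.def, hg]
    rw [hy', mul_zero]
  have outer (y : Fˣ) : (Finset.univ.filter fun α : Fˣ => P (α * y ^ e)).card =
      (Finset.univ.filter P).card :=
    Finset.card_equiv (Equiv.mulRight (y ^ e)) (by simp)
  have hcount := Finset.sum_card_bipartiteAbove_eq_sum_card_bipartiteBelow
    (s := (Finset.univ : Finset Fˣ)) (t := (Finset.univ : Finset Fˣ)) (fun α y => P (α * y ^ e))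
  simp only [Finset.bipartiteAbove, Finset.bipartiteBelow, outer] at hcount
  have hle := Finset.sum_le_sum fun (α : Fˣ) (_ : α ∈ Finset.univ) => inner α
  rw [hcount, Finset.sum_const, Finset.sum_const, smul_eq_mul, smul_eq_mul] at hle
  exact Nat.le_of_mul_le_mul_left hle (Finset.card_pos.2 ⟨1, Finset.mem_univ _⟩)

theorem stmt6 (F : Type*) [Field F] [Fintype F]
    (t : ℕ) (ht : 2 ≤ t) (c : Fin t → F) (a : Fin t → ℕ)
    (hc : ∀ i, c i ≠ 0) (ha : Function.Injective a)
    (f : Polynomial F) (hf : f = ∑ i, C (c i) * X ^ a i)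
    (Cf : ℕ)
    (hCf : ∀ k : ℕ, 0 < k → k ∣ Fintype.card F - 1 →
      (∃ α : F, α ≠ 0 ∧ ∀ x : F, x ^ k = α ^ k → f.eval x = 0) → k ≤ Cf) :
    (Set.ncard {x : F | x ≠ 0 ∧ f.eval x = 0} : ℝ) ≤
      2 * ((Fintype.card F - 1 : ℕ) : ℝ) ^ ((1 : ℝ) - 1 / ((t : ℝ) - 1)) *
        (Cf : ℝ) ^ ((1 : ℝ) / ((t : ℝ) - 1)) := by
  classical
  obtain ⟨d, rfl⟩ : ∃ d, t = d + 1 := ⟨t - 1, by omega⟩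
  have hd : 0 < d := by omega
  have hcard : Fintype.card F - 1 = Nat.card Fˣ := by
    rw [Nat.card_eq_fintype_card, Fintype.card_units]
  rw [hcard] at hCf ⊢
  set n := Nat.card Fˣ with hn_def
  have hn : 0 < n := Nat.card_pos
  have heval (x : F) : f.eval x = ∑ i, c i * x ^ a i := by simp [hf, eval_finsetSum]
  have hR : Set.ncard {x : F | x ≠ 0 ∧ f.eval x = 0} =
      (Finset.univ.filter fun x : Fˣ => ∑ i, c i * (x : F) ^ a i = 0).card := by
    rw [← Set.ncard_coe_finset, ← Set.ncard_image_of_injective _ Units.val_injective]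
    congr 1
    ext x
    constructor
    · rintro ⟨hx, h⟩
      exact ⟨Units.mk0 x hx, by simpa [heval] using h, rfl⟩
    · rintro ⟨y, hy, rfl⟩
      exact ⟨y.ne_zero, by simpa [heval] using hy⟩
  rw [hR]
  set R := (Finset.univ.filter fun x : Fˣ => ∑ i, c i * (x : F) ^ a i = 0) with hR_def
  rw [mul_assoc]
  set M : ℝ := (n : ℝ) ^ ((1 : ℝ) - 1 / (((d + 1 : ℕ) : ℝ) - 1)) *
    (Cf : ℝ) ^ ((1 : ℝ) / (((d + 1 : ℕ) : ℝ) - 1)) with hM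
  have hM0 : 0 ≤ M := by positivity
  rcases Finset.eq_empty_or_nonempty R with hE | ⟨x₀, hx₀⟩
  · rw [hE]; simpa using hM0
  have hCf1 : 1 ≤ Cf := hCf 1 one_pos (one_dvd _) ⟨x₀, x₀.ne_zero, fun x hx => by
    rw [pow_one, pow_one] at hx
    rw [hx, heval]
    simpa [hR_def] using hx₀⟩
  rcases le_or_gt (n : ℝ) M with hMn | hMn
  · have : (R.card : ℝ) ≤ n := by
      rw [hn_def, Nat.card_eq_fintype_card]
      exact_mod_cast Finset.card_le_univ R
    linarith
  have hMd : M ^ d * n = (n : ℝ) ^ d * Cf := by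
    have hd' : (d : ℝ) ≠ 0 := by exact_mod_cast hd.ne'
    have hn' : (0 : ℝ) < n := by exact_mod_cast hn
    rw [hM, mul_pow, ← Real.rpow_mul_natCast (by positivity),
      ← Real.rpow_mul_natCast (by positivity)]
    have e1 : ((1 : ℝ) - 1 / (((d + 1 : ℕ) : ℝ) - 1)) * d = d - 1 := by
      rw [Nat.cast_add_one, add_sub_cancel_right, sub_mul, one_div_mul_cancel hd', one_mul]
    have e2 : ((1 : ℝ) / (((d + 1 : ℕ) : ℝ) - 1)) * d = 1 := by
      rw [Nat.cast_add_one, add_sub_cancel_right, one_div_mul_cancel hd']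
    rw [e1, e2, Real.rpow_one, Real.rpow_sub_one hn'.ne', Real.rpow_natCast]
    field_simp
  set D := ⌊M⌋₊ with hD
  have hDM : (D : ℝ) ≤ M := Nat.floor_le hM0
  have hDn : D + 1 ≤ n := (Nat.floor_lt hM0).2 hMn
  have hpow : n ^ d * Cf < (D + 1) ^ d * n := by
    have h1 : M ^ d < ((D : ℝ) + 1) ^ d := pow_lt_pow_left₀ (Nat.lt_floor_add_one M) hM0 hd.ne'
    have h2 := mul_lt_mul_of_pos_right h1 (show (0 : ℝ) < n by exact_mod_cast hn)
    rw [hMd] at h2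
    exact_mod_cast h2
  let N := (n - 1) / Cf + 1
  have hN : n ≤ N * Cf := by
    have := Nat.lt_div_mul_add (a := n - 1) (b := Cf) hCf1
    simp only [N, add_mul, one_mul]; omega
  have hbox : n ^ d < N * (D + 1) ^ d := by
    refine Nat.lt_of_mul_lt_mul_right (a := Cf) (hpow.trans_le ?_)
    calc (D + 1) ^ d * n ≤ (D + 1) ^ d * (N * Cf) := Nat.mul_le_mul_left _ hN
      _ = N * (D + 1) ^ d * Cf := by ring
  obtain ⟨e, he, heN, v, hv⟩ := exists_small_simultaneous_multiple hn hDn hbox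
    (fun i : Fin d => (a i.succ : ℤ) - a 0)
  have heC : e * Cf < n := by
    have : e * Cf ≤ (n - 1) / Cf * Cf := Nat.mul_le_mul_right _ (by omega)
    have := Nat.div_mul_le_self (n - 1) Cf
    omega
  have hvan (α : Fˣ) : ∃ y : Fˣ, ∑ i, c i * ((α * y ^ e : Fˣ) : F) ^ a i ≠ 0 := by
    by_contra! hall
    have hg : 0 < e.gcd n := Nat.gcd_pos_of_pos_left _ he
    have hgn := Nat.gcd_dvd_right e n
    have hk : n / e.gcd n ≤ Cf := by
      refine hCf _ (Nat.div_pos (Nat.gcd_le_right _ hn) hg) (Nat.div_dvd_of_dvd hgn)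
        ⟨α, α.ne_zero, fun x hx => ?_⟩
      have hx0 : x ≠ 0 := by
        rintro rfl
        rw [zero_pow (Nat.div_pos (Nat.gcd_le_right _ hn) hg).ne'] at hx
        exact pow_ne_zero _ α.ne_zero hx.symm
      lift x to Fˣ using hx0.isUnit
      obtain ⟨y, hy⟩ := exists_pow_eq_of_pow_card_div_gcd_eq_one e (α⁻¹ * x) (by
        rw [mul_pow, inv_pow, inv_mul_eq_one]
        exact Units.ext (by push_cast; exact hx.symm))
      have := hall y
      rw [hy, mul_inv_cancel_left] at this
      rw [heval, this]
    have h1 : n ≤ e.gcd n * Cf := by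
      calc n = e.gcd n * (n / e.gcd n) := (Nat.mul_div_cancel' hgn).symm
        _ ≤ _ := Nat.mul_le_mul_left _ hk
    have h2 : e.gcd n * Cf ≤ e * Cf := Nat.mul_le_mul_right _ (Nat.gcd_le_left _ he)
    omega
  have hfin : R.card ≤ 2 * D := by
    refine card_units_zeros_le c a e D (a 0) (Fin.cons 0 v) (fun i => ?_) (fun i => ?_) hvan
    · refine Fin.cases (by simp) (fun j => ?_) i
      have := (hv j).1
      rw [Fin.cons_succ]
      push_cast at this; omega
    · exact Fin.cases (by simp) (fun j => by rw [Fin.cons_succ]; exact (hv j).2) i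
  have : (R.card : ℝ) ≤ 2 * D := by exact_mod_cast hfin
  linarith
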